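/- For any 𝐦, 𝐦' ∈ ℤ_{≥0}^{n−1} and any M, M' ∈ ℤ_{≥0}, the Minkowski sum of the sets of integer points satisfies S_{𝐦,M} + S_{𝐦',M'} = S_{𝐦+𝐦', M+M'}, where the Minkowski sum of two subsets A, B of ℤ^{P} is {a + b : a ∈ A, b ∈ B}. -/

import Mathlib

open scoped Pointwise

/-- The poset `P` of pairs `(i,j)` with `1 ≤ j < i ≤ n` (componentwise order). -/
def posetP (n : ℕ) : Finset (ℕ × ℕ) :=
  (Finset.range (n + 1) ×ˢ Finset.range (n + 1)).filter
    (fun p => 1 ≤ p.2 ∧ p.2 < p.1 ∧ p.1 ≤ n)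

/-- The subposet `P_d = {(i,j) ∈ P : i > d ≥ j}`. -/
def posetPd (n d : ℕ) : Finset (ℕ × ℕ) :=
  (posetP n).filter (fun p => d < p.1 ∧ p.2 ≤ d)

/-- The width of a finite subset of `ℕ × ℕ` (with the componentwise order):
the maximal cardinality of an antichain contained in it. -/
noncomputable def finWidth (Q : Finset (ℕ × ℕ)) : ℕ :=
  sSup (Finset.card '' {A : Finset (ℕ × ℕ) |
    A ⊆ Q ∧ IsAntichain (· ≤ ·) (A : Set (ℕ × ℕ))})

/-- The polytope `X_{𝐦,M} ⊆ ℝ_{≥0}^P`, realized as the set of functions `ℕ × ℕ → ℝ`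
supported on `P`, with nonnegative coordinates, satisfying for every `P' ⊆ P` the
inequality `Σ_{α ∈ P'} x_α ≤ M + Σ_{d=1}^{n-1} m_d · w(P' ∩ P_d)`. -/
def polytopeX (n : ℕ) (m : ℕ → ℕ) (M : ℕ) : Set (ℕ × ℕ → ℝ) :=
  {x | (∀ α, α ∉ posetP n → x α = 0) ∧ (∀ α, 0 ≤ x α) ∧
    ∀ P' ⊆ posetP n,
      ∑ α ∈ P', x α ≤
        (M : ℝ) + ∑ d ∈ Finset.Icc 1 (n - 1), (m d : ℝ) * (finWidth (P' ∩ posetPd n d) : ℝ)}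

/-- `S_{𝐦,M} = X_{𝐦,M} ∩ ℤ^P`: the set of integer points of the polytope. -/
def latticeS (n : ℕ) (m : ℕ → ℕ) (M : ℕ) : Set (ℕ × ℕ → ℤ) :=
  {x | (fun α => (x α : ℝ)) ∈ polytopeX n m M}

/-! ### Walks in a directed multigraph -/

/-- `IsWalk s t u v l`: the list of arcs `l` is a walk from `u` to `v`, where the arc `a` runs
from `s a` to `t a`. -/
def IsWalk {V A : Type*} (s t : A → V) : V → V → List A → Prop
  | u, v, [] => u = v
  | u, v, a :: l => s a = u ∧ IsWalk s t (t a) v l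

theorem isWalk_append {V A : Type*} {s t : A → V} {u v : V} {l₁ l₂ : List A} :
    IsWalk s t u v (l₁ ++ l₂) ↔ ∃ w, IsWalk s t u w l₁ ∧ IsWalk s t w v l₂ := by
  induction l₁ generalizing u with
  | nil => simp [IsWalk]
  | cons a l ih => simp [IsWalk, ih, and_assoc]

theorem IsWalk.sum_sub {V A : Type*} {s t : A → V} (ψ : V → ℤ) {u v : V} {l : List A}
    (h : IsWalk s t u v l) : (l.map fun a => ψ (t a) - ψ (s a)).sum = ψ v - ψ u := by
  induction l generalizing u with
  | nil => cases h; simp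
  | cons a l ih =>
    obtain ⟨rfl, h⟩ := h
    simp [ih h]

theorem List.exists_eq_append_cons_append_cons_of_not_nodup {A : Type*} {l : List A}
    (h : ¬ l.Nodup) : ∃ a l₁ l₂ l₃, l = l₁ ++ (a :: l₂) ++ (a :: l₃) := by
  induction l with
  | nil => simp at h
  | cons b l ih =>
    by_cases hb : b ∈ l
    · obtain ⟨l₂, l₃, rfl⟩ := List.append_of_mem hb
      exact ⟨b, [], l₂, l₃, rfl⟩
    · obtain ⟨a, l₁, l₂, l₃, rfl⟩ := ih fun hl => h (List.nodup_cons.2 ⟨hb, hl⟩)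
      exact ⟨a, b :: l₁, l₂, l₃, rfl⟩

/-- A walk repeating an arc splits into a shorter walk and a closed walk. -/
theorem IsWalk.exists_split {V A : Type*} {s t : A → V} (c : A → ℤ) {u v : V} {l : List A}
    (h : IsWalk s t u v l) (hl : ¬ l.Nodup) :
    ∃ w l₁ l₂, IsWalk s t u v l₁ ∧ IsWalk s t w w l₂ ∧ l₁.length < l.length ∧
      l₂.length < l.length ∧ (l.map c).sum = (l₁.map c).sum + (l₂.map c).sum := by
  obtain ⟨a, l₁, l₂, l₃, rfl⟩ := List.exists_eq_append_cons_append_cons_of_not_nodup hl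
  obtain ⟨w, h₁₂, rfl, h₃⟩ := isWalk_append.1 h
  obtain ⟨w', h₁, h₂⟩ := isWalk_append.1 h₁₂
  obtain rfl : s a = w' := h₂.1
  refine ⟨s a, l₁ ++ (a :: l₃), a :: l₂, isWalk_append.2 ⟨_, h₁, rfl, h₃⟩, h₂, ?_, ?_, ?_⟩
  · simp
  · simp; omega
  · simp; ring

/-- If no closed walk without repeated arcs has positive cost, there is a potential. -/
theorem exists_potential {V A : Type*} [Fintype A] (s t : A → V) (c : A → ℤ)
    (h : ∀ u l, IsWalk s t u u l → l.Nodup → (l.map c).sum ≤ 0) :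
    ∃ φ : V → ℤ, ∀ a, φ (s a) + c a ≤ φ (t a) := by
  classical
  have closed : ∀ k : ℕ, ∀ u l, l.length = k → IsWalk s t u u l → (l.map c).sum ≤ 0 := by
    intro k
    induction k using Nat.strong_induction_on with
    | _ k ih =>
      intro u l hk hl
      by_cases hn : l.Nodup
      · exact h u l hl hn
      · obtain ⟨w, l₁, l₂, h₁, h₂, hlt₁, hlt₂, hsum⟩ := hl.exists_split c hn
        have := ih _ (hk ▸ hlt₁) _ _ rfl h₁
        have := ih _ (hk ▸ hlt₂) _ _ rfl h₂
        omega
  have bound : ∀ k : ℕ, ∀ u v l, l.length = k → IsWalk s t u v l →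
      (l.map c).sum ≤ ∑ a, |c a| := by
    intro k
    induction k using Nat.strong_induction_on with
    | _ k ih =>
      intro u v l hk hl
      by_cases hn : l.Nodup
      · rw [← List.sum_toFinset c hn]
        exact (Finset.sum_le_sum fun a _ => le_abs_self (c a)).trans
          (Finset.sum_le_sum_of_subset_of_nonneg (Finset.subset_univ _) fun a _ _ => abs_nonneg _)
      · obtain ⟨w, l₁, l₂, h₁, h₂, hlt₁, -, hsum⟩ := hl.exists_split c hn
        have := ih _ (hk ▸ hlt₁) _ _ _ rfl h₁
        have := closed _ _ _ rfl h₂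
        omega
  let costs : V → Set ℤ := fun v => {z | ∃ u l, IsWalk s t u v l ∧ (l.map c).sum = z}
  have bdd : ∀ v, BddAbove (costs v) := fun v => ⟨∑ a, |c a|, by
    rintro _ ⟨u, l, hl, rfl⟩
    exact bound _ _ _ _ rfl hl⟩
  have ne : ∀ v, (costs v).Nonempty := fun v => ⟨0, v, [], rfl, rfl⟩
  refine ⟨fun v => sSup (costs v), fun a => ?_⟩
  obtain ⟨u, l, hl, hsum⟩ := Int.csSup_mem (ne (s a)) (bdd (s a))
  refine le_csSup (bdd (t a)) ⟨u, l ++ [a], isWalk_append.2 ⟨s a, hl, rfl, rfl⟩, ?_⟩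
  simp [hsum]

/-! ### Circulations of maximal cost -/

/-- Nonnegative integral circulations with capacity one on the arcs that are not `hard`; flow
conservation is stated by testing against potentials. -/
structure IsCirculation {V E : Type*} [Fintype E] (src tgt : E → V) (hard : E → Prop)
    (f : E → ℤ) : Prop where
  nonneg : ∀ e, 0 ≤ f e
  le_one : ∀ e, ¬ hard e → f e ≤ 1
  conserved : ∀ ψ : V → ℤ, ∑ e, f e * (ψ (tgt e) - ψ (src e)) = 0

/-- If costs of circulations are bounded, there are a circulation and a potential which satisfy
complementary slackness. -/
theorem exists_circulation_potential {V E : Type*} [Fintype E] (src tgt : E → V)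
    (hard : E → Prop) (c : E → ℤ) (B : ℤ)
    (hB : ∀ f, IsCirculation src tgt hard f → ∑ e, f e * c e ≤ B) :
    ∃ (f : E → ℤ) (φ : V → ℤ), IsCirculation src tgt hard f ∧
      (∀ e, hard e ∨ f e < 1 → φ (src e) + c e ≤ φ (tgt e)) ∧
      (∀ e, 0 < f e → φ (tgt e) ≤ φ (src e) + c e) := by
  classical
  obtain ⟨_, ⟨f, hf, rfl⟩, hmax⟩ :
      ∃ z, (∃ f, IsCirculation src tgt hard f ∧ ∑ e, f e * c e = z) ∧
        ∀ y, (∃ f, IsCirculation src tgt hard f ∧ ∑ e, f e * c e = y) → y ≤ z :=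
    Int.exists_greatest_of_bdd ⟨B, by rintro _ ⟨f, hf, rfl⟩; exact hB f hf⟩
      ⟨0, fun _ => 0, ⟨by simp, by simp, by simp⟩, by simp⟩
  let allowed : E × Bool → Prop := fun a => (a.2 = true ∧ (hard a.1 ∨ f a.1 < 1)) ∨
    (a.2 = false ∧ 0 < f a.1)
  let s : {a // allowed a} → V := fun a => if a.1.2 then src a.1.1 else tgt a.1.1
  let t : {a // allowed a} → V := fun a => if a.1.2 then tgt a.1.1 else src a.1.1
  let sgn : E × Bool → ℤ := fun a => if a.2 then 1 else -1
  have key : ∀ u l, IsWalk s t u u l → l.Nodup →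
      (l.map fun a => sgn a.1 * c a.1.1).sum ≤ 0 := by
    intro u l hl hn
    let L : Finset (E × Bool) := l.toFinset.map (Function.Embedding.subtype _)
    have hL : ∀ a ∈ L, allowed a := by
      intro a ha
      obtain ⟨b, -, rfl⟩ := Finset.mem_map.1 ha
      exact b.2
    let χ : E → ℤ := fun e => (if (e, true) ∈ L then 1 else 0) - (if (e, false) ∈ L then 1 else 0)
    have hχ : ∀ g : E → ℤ, ∑ e, χ e * g e = (l.map fun a => sgn a.1 * g a.1.1).sum := by
      intro g
      rw [← List.sum_toFinset _ hn]
      have : ∑ a ∈ L, sgn a * g a.1 = ∑ a ∈ l.toFinset, sgn a.1 * g a.1.1 :=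
        Finset.sum_map _ _ _
      rw [← this, ← Finset.univ_inter L, ← Finset.sum_ite_mem, Fintype.sum_prod_type]
      refine Finset.sum_congr rfl fun e _ => ?_
      simp only [Fintype.sum_bool, χ, sgn, Bool.false_eq_true, if_true, if_false]
      split_ifs <;> simp
    have hcirc : IsCirculation src tgt hard fun e => f e + χ e := by
      refine ⟨fun e => ?_, fun e he => ?_, fun ψ => ?_⟩
      · have := hf.nonneg e
        have := hL (e, false)
        simp only [χ]
        simp only [allowed] at this
        split_ifs <;> simp_all <;> omega
      · have := hf.le_one e he
        have := hL (e, true)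
        simp only [χ]
        simp only [allowed] at this
        split_ifs <;> simp_all <;> omega
      · simp only [add_mul, Finset.sum_add_distrib, hf.conserved ψ, zero_add]
        rw [hχ fun e => ψ (tgt e) - ψ (src e)]
        refine Eq.trans ?_ ((hl.sum_sub ψ).trans (sub_self _))
        congr 1
        refine List.map_congr_left fun a _ => ?_
        simp only [sgn, s, t]
        split_ifs <;> ring
    have := hmax _ ⟨_, hcirc, rfl⟩
    simp only [add_mul, Finset.sum_add_distrib, hχ c] at this
    omega
  obtain ⟨φ, hφ⟩ := exists_potential s t (fun a => sgn a.1 * c a.1.1) key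
  refine ⟨f, φ, hf, fun e he => ?_, fun e he => ?_⟩
  · simpa [s, t, sgn] using hφ ⟨(e, true), by simpa [allowed] using he⟩
  · have := hφ ⟨(e, false), by simpa [allowed] using he⟩
    simp [s, t, sgn] at this
    omega

/-! ### Covering a weight function by level sets of a potential -/

/-- The partial sums `m 1 + ⋯ + m k`. -/
def partialSum (m : ℕ → ℕ) (k : ℕ) : ℤ := ∑ d ∈ Finset.Icc 1 k, (m d : ℤ)

theorem partialSum_mono (m : ℕ → ℕ) : Monotone (partialSum m) := fun _ _ h =>
  Finset.sum_le_sum_of_subset_of_nonneg (Finset.Icc_subset_Icc le_rfl h) fun _ _ _ => by positivity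

theorem partialSum_eq_sum_ite (m : ℕ → ℕ) {k N : ℕ} (h : k ≤ N) :
    partialSum m k = ∑ d ∈ Finset.Icc 1 N, (m d : ℤ) * if d ≤ k then 1 else 0 := by
  simp only [mul_ite, mul_one, mul_zero, ← Finset.sum_filter, partialSum]
  refine Finset.sum_congr ?_ fun _ _ => rfl
  ext d
  simp
  omega

/-- The constraints for the arrival and departure potentials `u` and `v` on `s`. -/
structure IsPotentialPair {ι : Type*} [PartialOrder ι] (s : Finset ι) (lo hi : ι → ℕ) (m : ℕ → ℕ)
    (u v : ι → ℤ) : Prop where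
  le : ∀ α ∈ s, u α ≤ v α
  step : ∀ α ∈ s, ∀ β ∈ s, α < β → v α ≤ u β
  lower : ∀ α ∈ s, partialSum m (lo α) ≤ u α
  upper : ∀ α ∈ s, v α ≤ partialSum m (hi α)

/-- Min-max theorem: the uncovered part of `x` for an optimal potential pair is certified by
a subset `Q` together with bounds on the antichains of `Q` at each level `d`. -/
theorem exists_potentialPair {ι : Type*} [PartialOrder ι] (s : Finset ι) (lo hi : ι → ℕ)
    (m : ℕ → ℕ) (N : ℕ) (lo_mono : ∀ α ∈ s, ∀ β ∈ s, α ≤ β → lo α ≤ lo β)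
    (hi_mono : ∀ α ∈ s, ∀ β ∈ s, α ≤ β → hi α ≤ hi β) (lo_le : ∀ α ∈ s, lo α ≤ hi α)
    (hi_le : ∀ α ∈ s, hi α ≤ N) (x : ι → ℤ) (hx : ∀ α ∈ s, 0 ≤ x α) :
    ∃ (u v : ι → ℤ) (Q : Finset ι) (w : ℕ → ℤ), IsPotentialPair s lo hi m u v ∧ Q ⊆ s ∧
      (∀ d, ∀ A ⊆ Q, IsAntichain (· ≤ ·) (A : Set ι) → (∀ α ∈ A, lo α < d ∧ d ≤ hi α) →
        (A.card : ℤ) ≤ w d) ∧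
      ∑ α ∈ s, max 0 (x α - (v α - u α)) =
        ∑ α ∈ Q, x α - ∑ d ∈ Finset.Icc 1 N, (m d : ℤ) * w d := by
  classical
  -- the arcs are, in this order: unit capacity and unbounded arcs through the elements of `s`,
  -- arcs from and to the root, and arcs between comparable elements
  let E := s ⊕ (s ⊕ (s ⊕ (s ⊕ {p : s × s // p.1 < p.2})))
  let V := Option (ι × Bool)
  let src : E → V := Sum.elim (fun α => some (α, false)) <| Sum.elim (fun α => some (α, false)) <|
    Sum.elim (fun _ => none) <| Sum.elim (fun α => some (α, true)) fun p => some (p.1.1, true)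
  let tgt : E → V := Sum.elim (fun α => some (α, true)) <| Sum.elim (fun α => some (α, true)) <|
    Sum.elim (fun α => some (α, false)) <| Sum.elim (fun _ => none) fun p => some (p.1.2, false)
  let c : E → ℤ := Sum.elim (fun α => x α) <| Sum.elim (fun _ => 0) <|
    Sum.elim (fun α => partialSum m (lo α)) <| Sum.elim (fun α => -partialSum m (hi α)) fun _ => 0
  let hard : E → Prop := Sum.elim (fun _ => False) fun _ => True
  have sum_E : ∀ F : E → ℤ, ∑ e, F e = ∑ α, F (Sum.inl α) + (∑ α, F (Sum.inr (Sum.inl α)) +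
      (∑ α, F (Sum.inr (Sum.inr (Sum.inl α))) + (∑ α, F (Sum.inr (Sum.inr (Sum.inr (Sum.inl α)))) +
        ∑ p, F (Sum.inr (Sum.inr (Sum.inr (Sum.inr p))))))) := by
    intro F
    rw [Fintype.sum_sum_type, Fintype.sum_sum_type, Fintype.sum_sum_type, Fintype.sum_sum_type]
  have reduced : ∀ f, IsCirculation src tgt hard f → ∀ ψ : V → ℤ,
      ∑ e, f e * c e = ∑ e, f e * (c e + ψ (src e) - ψ (tgt e)) := by
    intro f hf ψ
    rw [← sub_eq_zero, ← Finset.sum_sub_distrib, ← hf.conserved ψ]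
    exact Finset.sum_congr rfl fun e _ => by ring
  obtain ⟨f, φ, hf, hφ, hφ'⟩ := exists_circulation_potential src tgt hard c (∑ α : s, x α) (by
    intro f hf
    rw [reduced f hf fun a => a.elim 0 fun p => if p.1 ∈ s then partialSum m (lo p.1) else 0,
      Fintype.sum_sum_type, ← add_zero (∑ α : s, x α)]
    refine add_le_add (Finset.sum_le_sum fun α _ => ?_) (Finset.sum_nonpos fun e _ => ?_)
    · have := hf.le_one (Sum.inl α) (by simp [hard])
      have := hx α α.2
      simp [c, src, tgt]
      nlinarith
    · refine mul_nonpos_of_nonneg_of_nonpos (hf.nonneg _) ?_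
      rcases e with α | α | α | ⟨⟨α, β⟩, h⟩
      · simp [c, src, tgt]
      · simp [c, src, tgt]
      · have := partialSum_mono m (lo_le α α.2)
        simp [c, src, tgt]
        omega
      · have := partialSum_mono m (lo_mono α α.2 β β.2 (le_of_lt h))
        simp [c, src, tgt]
        omega)
  let u : ι → ℤ := fun α => φ (some (α, false)) - φ none
  let v : ι → ℤ := fun α => φ (some (α, true)) - φ none
  have hard_inr : ∀ e, hard (Sum.inr e) := fun e => trivial
  have pair : IsPotentialPair s lo hi m u v := by
    refine ⟨fun α hα => ?_, fun α hα β hβ h => ?_, fun α hα => ?_, fun α hα => ?_⟩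
    · have := hφ (Sum.inr (Sum.inl ⟨α, hα⟩)) (Or.inl (hard_inr _))
      simp [src, tgt, c, u, v] at this ⊢
      omega
    · have := hφ (Sum.inr (Sum.inr (Sum.inr (Sum.inr ⟨(⟨α, hα⟩, ⟨β, hβ⟩), h⟩))))
        (Or.inl (hard_inr _))
      simp [src, tgt, c, u, v] at this ⊢
      omega
    · have := hφ (Sum.inr (Sum.inr (Sum.inl ⟨α, hα⟩))) (Or.inl (hard_inr _))
      simp [src, tgt, c, u] at this ⊢
      omega
    · have := hφ (Sum.inr (Sum.inr (Sum.inr (Sum.inl ⟨α, hα⟩)))) (Or.inl (hard_inr _))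
      simp [src, tgt, c, v] at this ⊢
      omega
  let pass : s → ℤ := fun α => f (Sum.inl α)
  let enter : s → ℤ := fun α => f (Sum.inr (Sum.inr (Sum.inl α)))
  let leave : s → ℤ := fun α => f (Sum.inr (Sum.inr (Sum.inr (Sum.inl α))))
  have pass_cases : ∀ α, pass α = 0 ∨ pass α = 1 := by
    intro α
    have := hf.nonneg (Sum.inl α)
    have := hf.le_one (Sum.inl α) (by simp [hard])
    simp only [pass]
    omega
  have enter_nonneg : ∀ α, 0 ≤ enter α := fun α => hf.nonneg _
  have leave_nonneg : ∀ α, 0 ≤ leave α := fun α => hf.nonneg _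
  let Q : Finset ι := (Finset.univ.filter fun α => pass α = 1).map (Function.Embedding.subtype _)
  have sum_Q : ∀ g : ι → ℤ, ∑ α ∈ Q, g α = ∑ α, pass α * g α := by
    intro g
    simp only [Q, Finset.sum_map, Finset.sum_filter]
    refine Finset.sum_congr rfl fun α _ => ?_
    rcases pass_cases α with h | h <;> simp [h]
  have sub_s : Q ⊆ s := by
    intro α hα
    obtain ⟨β, -, rfl⟩ := Finset.mem_map.1 hα
    exact β.2
  refine ⟨u, v, Q, fun d => ∑ α : s, leave α * (if d ≤ hi α then 1 else 0) -
    ∑ α : s, enter α * (if d ≤ lo α then 1 else 0), pair, sub_s, ?_, ?_⟩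
  · intro d A hAQ hA hd
    let below : ι → Prop := fun α => ∃ a ∈ A, a ≤ α
    let sbelow : ι → Prop := fun α => ∃ a ∈ A, a < α
    have below_hi : ∀ α ∈ s, below α → d ≤ hi α := by
      rintro α hα ⟨a, ha, hle⟩
      exact (hd a ha).2.trans (hi_mono a (sub_s (hAQ ha)) α hα hle)
    have sbelow_below : ∀ α, sbelow α → below α := fun α ⟨a, ha, h⟩ => ⟨a, ha, h.le⟩
    let ψ : V → ℤ := fun a => a.elim 0 fun p =>
      if d ≤ lo p.1 ∨ (if p.2 then below p.1 else sbelow p.1) then 1 else 0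
    have hsum := hf.conserved ψ
    rw [sum_E] at hsum
    have hA' : (A.card : ℤ) ≤ ∑ α : s, pass α * ((if d ≤ lo α ∨ below α then 1 else 0) -
        (if d ≤ lo α ∨ sbelow α then 1 else 0)) := by
      rw [← sum_Q fun α => (if d ≤ lo α ∨ below α then 1 else 0) -
        (if d ≤ lo α ∨ sbelow α then 1 else 0), Finset.card_eq_sum_ones, Nat.cast_sum]
      refine (Finset.sum_le_sum fun α hα => ?_).trans
        (Finset.sum_le_sum_of_subset_of_nonneg hAQ fun α _ _ => ?_)
      · have h₁ : below α := ⟨α, hα, le_rfl⟩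
        have h₂ : ¬ sbelow α := fun ⟨a, ha, h⟩ => hA ha hα h.ne h.le
        simp [h₁, h₂, (hd α hα).1.not_ge]
      · have := sbelow_below α
        split_ifs <;> grind
    have hpass : ∑ α : s, pass α * ((if d ≤ lo α ∨ below α then 1 else 0) -
        (if d ≤ lo α ∨ sbelow α then 1 else 0)) = ∑ α : s, f (Sum.inl α) *
          (ψ (tgt (Sum.inl α)) - ψ (src (Sum.inl α))) :=
      Finset.sum_congr rfl fun α _ => by simp [ψ, tgt, src, pass]
    have hhold : 0 ≤ ∑ α : s, f (Sum.inr (Sum.inl α)) *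
        (ψ (tgt (Sum.inr (Sum.inl α))) - ψ (src (Sum.inr (Sum.inl α)))) := by
      refine Finset.sum_nonneg fun α _ => mul_nonneg (hf.nonneg _) ?_
      have := sbelow_below α
      simp only [ψ, tgt, src, Sum.elim_inr, Sum.elim_inl, Option.elim_some, if_true,
        Bool.false_eq_true, if_false]
      split_ifs <;> grind
    have henter : ∑ α : s, enter α * (if d ≤ lo α then 1 else 0) ≤
        ∑ α : s, f (Sum.inr (Sum.inr (Sum.inl α))) * (ψ (tgt (Sum.inr (Sum.inr (Sum.inl α)))) -
          ψ (src (Sum.inr (Sum.inr (Sum.inl α))))) := by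
      refine Finset.sum_le_sum fun α _ => mul_le_mul_of_nonneg_left ?_ (enter_nonneg α)
      simp only [ψ, tgt, src, Sum.elim_inr, Sum.elim_inl, Option.elim_some, Option.elim_none,
        Bool.false_eq_true, if_false]
      split_ifs <;> grind
    have hleave : -∑ α : s, leave α * (if d ≤ hi α then 1 else 0) ≤
        ∑ α : s, f (Sum.inr (Sum.inr (Sum.inr (Sum.inl α)))) *
          (ψ (tgt (Sum.inr (Sum.inr (Sum.inr (Sum.inl α))))) -
            ψ (src (Sum.inr (Sum.inr (Sum.inr (Sum.inl α)))))) := by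
      rw [← Finset.sum_neg_distrib]
      refine Finset.sum_le_sum fun α _ => ?_
      rw [← mul_neg]
      refine mul_le_mul_of_nonneg_left ?_ (leave_nonneg α)
      have := below_hi α α.2
      have := lo_le α α.2
      simp only [ψ, tgt, src, Sum.elim_inr, Sum.elim_inl, Option.elim_some, Option.elim_none,
        if_true]
      split_ifs <;> grind
    have hstep : 0 ≤ ∑ p : {p : s × s // p.1 < p.2},
        f (Sum.inr (Sum.inr (Sum.inr (Sum.inr p)))) *
          (ψ (tgt (Sum.inr (Sum.inr (Sum.inr (Sum.inr p))))) -
            ψ (src (Sum.inr (Sum.inr (Sum.inr (Sum.inr p)))))) := by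
      refine Finset.sum_nonneg fun p _ => mul_nonneg (hf.nonneg _) ?_
      obtain ⟨⟨α, β⟩, h⟩ := p
      have h₁ := lo_mono α α.2 β β.2 (le_of_lt h)
      have h₂ : below α → sbelow β := fun ⟨a, ha, hle⟩ => ⟨a, ha, lt_of_le_of_lt hle h⟩
      simp only [ψ, tgt, src, Sum.elim_inr, Option.elim_some, if_true,
        Bool.false_eq_true, if_false]
      split_ifs <;> grind
    linarith
  · have slack : ∑ α ∈ s, max 0 (x α - (v α - u α)) =
        ∑ e, f e * (c e + φ (src e) - φ (tgt e)) := by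
      rw [Fintype.sum_sum_type, ← Finset.sum_coe_sort, Finset.sum_eq_zero (s := Finset.univ)
        (f := fun e => f (Sum.inr e) * _), add_zero]
      · refine Finset.sum_congr rfl fun α _ => ?_
        have h₁ := hφ (Sum.inl α)
        have h₂ := hφ' (Sum.inl α)
        have h₃ := pass_cases α
        simp only [pass] at h₃
        simp only [src, tgt, c, hard, Sum.elim_inl, false_or, u, v] at h₁ h₂ ⊢
        rcases h₃ with h | h <;> simp [h] at h₁ h₂ ⊢ <;> omega
      · intro e _
        have h₁ := hφ (Sum.inr e) (Or.inl (hard_inr e))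
        have h₂ := hφ' (Sum.inr e)
        rcases (hf.nonneg (Sum.inr e)).eq_or_lt with h | h
        · rw [← h, zero_mul]
        · have := h₂ h
          exact mul_eq_zero_of_right _ (by omega)
    have swap : ∀ (g : s → ℤ) (k : ι → ℕ), (∀ α ∈ s, k α ≤ N) →
        ∑ α : s, g α * partialSum m (k α) =
          ∑ d ∈ Finset.Icc 1 N, (m d : ℤ) * ∑ α : s, g α * if d ≤ k α then 1 else 0 := by
      intro g k hk
      simp_rw [Finset.mul_sum]
      rw [Finset.sum_comm]
      refine Finset.sum_congr rfl fun α _ => ?_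
      rw [partialSum_eq_sum_ite m (hk α α.2), Finset.mul_sum]
      exact Finset.sum_congr rfl fun d _ => by ring
    rw [slack, ← reduced f hf φ, sum_Q, sum_E]
    simp only [mul_sub, Finset.sum_sub_distrib]
    rw [← swap leave hi hi_le, ← swap enter lo fun α hα => (lo_le α hα).trans (hi_le α hα)]
    simp [c, pass, enter, leave]
    ring

/-! ### Counting levels below an integer -/

/-- The number of levels `a d + k < z` with `1 ≤ d ≤ N` and `k < m d`. -/
def levelCount (a : ℕ → ℤ) (m : ℕ → ℕ) (N : ℕ) (z : ℤ) : ℤ :=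
  ∑ d ∈ Finset.Icc 1 N, ∑ k ∈ Finset.range (m d), if a d + k < z then 1 else 0

theorem levelCount_mono (a : ℕ → ℤ) (m : ℕ → ℕ) (N : ℕ) : Monotone (levelCount a m N) := by
  intro y z h
  refine Finset.sum_le_sum fun d _ => Finset.sum_le_sum fun k _ => ?_
  split_ifs <;> omega

theorem levelCount_add (a : ℕ → ℤ) (m m' : ℕ → ℕ) (N : ℕ) (z : ℤ) :
    levelCount a m N z + levelCount (fun d => a d + m d) m' N z =
      levelCount a (fun d => m d + m' d) N z := by
  simp only [levelCount, ← Finset.sum_add_distrib, Finset.sum_range_add]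
  push_cast
  simp only [add_assoc]

theorem sum_range_ite_lt (a : ℤ) (m : ℕ) (z : ℤ) :
    (∑ k ∈ Finset.range m, if a + k < z then (1 : ℤ) else 0) = max 0 (min (z - a) m) := by
  induction m with
  | zero => simp
  | succ m ih =>
    rw [Finset.sum_range_succ, ih]
    push_cast
    split_ifs <;> omega

theorem levelCount_partialSum (m : ℕ → ℕ) (N : ℕ) {z : ℤ} (hz : 0 ≤ z) :
    levelCount (fun d => partialSum m (d - 1)) m N z = min z (partialSum m N) := by
  induction N with
  | zero => simp [levelCount, partialSum, hz]
  | succ N ih =>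
    have h₁ : partialSum m (N + 1) = partialSum m N + m (N + 1) :=
      Finset.sum_Icc_succ_top (by omega) _
    rw [levelCount] at ih ⊢
    rw [Finset.sum_Icc_succ_top (by omega), ih, sum_range_ite_lt, h₁, Nat.add_sub_cancel]
    have : 0 ≤ partialSum m N := Finset.sum_nonneg fun _ _ => by positivity
    omega

/-! ### Integer points of the polytopes -/

theorem bddAbove_card_antichain (Q : Finset (ℕ × ℕ)) :
    BddAbove (Finset.card '' {A : Finset (ℕ × ℕ) |
      A ⊆ Q ∧ IsAntichain (· ≤ ·) (A : Set (ℕ × ℕ))}) :=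
  ⟨Q.card, by rintro _ ⟨A, hA, rfl⟩; exact Finset.card_le_card hA.1⟩

theorem card_le_finWidth {Q A : Finset (ℕ × ℕ)} (hAQ : A ⊆ Q)
    (hA : IsAntichain (· ≤ ·) (A : Set (ℕ × ℕ))) : A.card ≤ finWidth Q :=
  le_csSup (bddAbove_card_antichain Q) ⟨A, ⟨hAQ, hA⟩, rfl⟩

theorem exists_card_eq_finWidth (Q : Finset (ℕ × ℕ)) :
    ∃ A ⊆ Q, IsAntichain (· ≤ ·) (A : Set (ℕ × ℕ)) ∧ A.card = finWidth Q := by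
  obtain ⟨A, hA, h⟩ := Nat.sSup_mem (s := Finset.card '' {A : Finset (ℕ × ℕ) |
    A ⊆ Q ∧ IsAntichain (· ≤ ·) (A : Set (ℕ × ℕ))}) ⟨0, ∅, by simp, rfl⟩ (bddAbove_card_antichain Q)
  exact ⟨A, hA.1, hA.2, h⟩

theorem mem_posetP {n : ℕ} {p : ℕ × ℕ} : p ∈ posetP n ↔ 1 ≤ p.2 ∧ p.2 < p.1 ∧ p.1 ≤ n := by
  simp only [posetP, Finset.mem_filter, Finset.mem_product, Finset.mem_range]
  omega

theorem mem_latticeS {n : ℕ} {m : ℕ → ℕ} {M : ℕ} {x : ℕ × ℕ → ℤ} :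
    x ∈ latticeS n m M ↔ (∀ α, α ∉ posetP n → x α = 0) ∧ (∀ α, 0 ≤ x α) ∧
      ∀ P' ⊆ posetP n, ∑ α ∈ P', x α ≤
        (M : ℤ) + ∑ d ∈ Finset.Icc 1 (n - 1), (m d : ℤ) * (finWidth (P' ∩ posetPd n d) : ℤ) := by
  simp only [latticeS, polytopeX, Set.mem_ofPred_eq]
  norm_cast

/-- Each level of a potential pair meets a subset `Q` in an antichain. -/
theorem IsPotentialPair.sum_level_le {n : ℕ} {m : ℕ → ℕ} {u v : ℕ × ℕ → ℤ}
    (h : IsPotentialPair (posetP n) (fun p => p.2 - 1) (fun p => p.1 - 1) m u v)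
    {Q : Finset (ℕ × ℕ)} (hQ : Q ⊆ posetP n) {d : ℕ} {t : ℤ}
    (ht : partialSum m (d - 1) ≤ t) (ht' : t < partialSum m d) :
    ∑ α ∈ Q, ((if t < v α then 1 else 0) - if t < u α then 1 else 0) ≤
      (finWidth (Q ∩ posetPd n d) : ℤ) := by
  have hsub : Q.filter (fun α => u α ≤ t ∧ t < v α) ⊆ Q ∩ posetPd n d := by
    intro α hα
    obtain ⟨hα, hu, hv⟩ := Finset.mem_filter.1 hα
    refine Finset.mem_inter.2 ⟨hα, Finset.mem_filter.2 ⟨hQ hα, ?_, ?_⟩⟩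
    · by_contra hlt
      have := h.upper α (hQ hα)
      have := partialSum_mono m (show α.1 - 1 ≤ d - 1 by omega)
      omega
    · by_contra hlt
      have := h.lower α (hQ hα)
      have := partialSum_mono m (show d ≤ α.2 - 1 by omega)
      omega
  refine le_trans (le_of_eq ?_) (Nat.cast_le.2 (card_le_finWidth hsub ?_))
  · rw [Finset.card_filter]
    push_cast
    refine Finset.sum_congr rfl fun α hα => ?_
    have := h.le α (hQ hα)
    split_ifs <;> omega
  · intro α hα β hβ hne hle
    obtain ⟨hα, -, hv⟩ := Finset.mem_filter.1 hα
    obtain ⟨hβ, hu, -⟩ := Finset.mem_filter.1 hβ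
    have := h.step α (hQ hα) β (hQ hβ) (lt_of_le_of_ne hle hne)
    omega

theorem IsPotentialPair.mem_latticeS_of_le {n : ℕ} {m : ℕ → ℕ} {u v : ℕ × ℕ → ℤ}
    (h : IsPotentialPair (posetP n) (fun p => p.2 - 1) (fun p => p.1 - 1) m u v)
    {a : ℕ → ℤ} {m₁ : ℕ → ℕ} (ha : ∀ d, 1 ≤ d → partialSum m (d - 1) ≤ a d)
    (ha' : ∀ d, 1 ≤ d → a d + m₁ d ≤ partialSum m d) {y z : ℕ × ℕ → ℤ} {M : ℕ}
    (hy : ∀ α, α ∉ posetP n → y α = 0) (hy₀ : ∀ α, 0 ≤ y α) (hz : ∀ α ∈ posetP n, 0 ≤ z α)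
    (hzM : ∑ α ∈ posetP n, z α ≤ M)
    (hle : ∀ α ∈ posetP n,
      y α ≤ levelCount a m₁ (n - 1) (v α) - levelCount a m₁ (n - 1) (u α) + z α) :
    y ∈ latticeS n m₁ M := by
  refine mem_latticeS.2 ⟨hy, hy₀, fun Q hQ => ?_⟩
  calc ∑ α ∈ Q, y α
      ≤ ∑ α ∈ Q, (z α + (levelCount a m₁ (n - 1) (v α) - levelCount a m₁ (n - 1) (u α))) :=
        Finset.sum_le_sum fun α hα => (hle α (hQ hα)).trans_eq (add_comm _ _)
    _ = ∑ α ∈ Q, z α + ∑ d ∈ Finset.Icc 1 (n - 1), ∑ k ∈ Finset.range (m₁ d),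
          ∑ α ∈ Q, ((if a d + k < v α then 1 else 0) - if a d + k < u α then 1 else 0) := by
        simp only [levelCount, Finset.sum_add_distrib, ← Finset.sum_sub_distrib]
        congr 1
        rw [Finset.sum_comm]
        exact Finset.sum_congr rfl fun d _ => Finset.sum_comm
    _ ≤ _ := by
        refine add_le_add ((Finset.sum_le_sum_of_subset_of_nonneg hQ fun α hα _ => hz α hα).trans
          hzM) (Finset.sum_le_sum fun d hd => ?_)
        have hd := (Finset.mem_Icc.1 hd).1
        have hlo := ha d hd
        have hhi := ha' d hd
        rw [← nsmul_eq_mul]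
        refine (Finset.sum_le_card_nsmul _ _ _ fun k hk => ?_).trans_eq (by rw [Finset.card_range])
        have := Finset.mem_range.1 hk
        exact h.sum_level_le hQ (by omega) (by omega)

theorem exists_split_of_sum_le {ι : Type*} (s : Finset ι) (z : ι → ℤ) (hz : ∀ α ∈ s, 0 ≤ z α)
    {A B : ℤ} (hA : 0 ≤ A) (hB : 0 ≤ B) (h : ∑ α ∈ s, z α ≤ A + B) :
    ∃ w : ι → ℤ, (∀ α ∈ s, 0 ≤ w α ∧ w α ≤ z α) ∧ ∑ α ∈ s, w α ≤ A ∧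
      ∑ α ∈ s, (z α - w α) ≤ B := by
  classical
  induction s using Finset.induction_on generalizing A B with
  | empty => exact ⟨0, by simp, by simpa, by simpa⟩
  | insert b s hb ih =>
    have hzb := hz b (Finset.mem_insert_self b s)
    have hzs : ∀ α ∈ s, 0 ≤ z α := fun α hα => hz α (Finset.mem_insert_of_mem hα)
    have hnn := Finset.sum_nonneg hzs
    rw [Finset.sum_insert hb] at h
    obtain ⟨w, hw, hwA, hwB⟩ := ih hzs (A := A - min (z b) A) (B := B - (z b - min (z b) A))
      (by omega) (by omega) (by omega)
    have hne : ∀ α ∈ s, α ≠ b := fun α hα hab => hb (hab ▸ hα)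
    refine ⟨Function.update w b (min (z b) A), fun α hα => ?_, ?_, ?_⟩
    · rcases Finset.mem_insert.1 hα with rfl | hα
      · simp only [Function.update_self]
        omega
      · simpa only [Function.update_of_ne (hne α hα)] using hw α hα
    · have : ∑ α ∈ s, Function.update w b (min (z b) A) α = ∑ α ∈ s, w α :=
        Finset.sum_congr rfl fun α hα => Function.update_of_ne (hne α hα) _ w
      rw [Finset.sum_insert hb, this, Function.update_self]
      omega
    · have : ∑ α ∈ s, (z α - Function.update w b (min (z b) A) α) = ∑ α ∈ s, (z α - w α) :=
        Finset.sum_congr rfl fun α hα => by rw [Function.update_of_ne (hne α hα)]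
      rw [Finset.sum_insert hb, this, Function.update_self]
      omega

theorem latticeS_add_subset (n : ℕ) (m m' : ℕ → ℕ) (M M' : ℕ) :
    latticeS n m M + latticeS n m' M' ⊆ latticeS n (fun d => m d + m' d) (M + M') := by
  rintro _ ⟨x, hx, y, hy, rfl⟩
  rw [mem_latticeS] at hx hy ⊢
  refine ⟨fun α hα => by simp [hx.1 α hα, hy.1 α hα], fun α => add_nonneg (hx.2.1 α) (hy.2.1 α),
    fun Q hQ => ?_⟩
  have h₁ := hx.2.2 Q hQ
  have h₂ := hy.2.2 Q hQ
  simp only [Pi.add_apply, Finset.sum_add_distrib, Nat.cast_add, add_mul]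
  linarith

/-- Minkowski sum property for integer points:
`S_{𝐦,M} + S_{𝐦',M'} = S_{𝐦+𝐦',M+M'}`. -/
theorem statement2 (n : ℕ) (hn : 2 ≤ n) (m m' : ℕ → ℕ) (M M' : ℕ) :
    latticeS n m M + latticeS n m' M' = latticeS n (fun d => m d + m' d) (M + M') := by
  refine (latticeS_add_subset n m m' M M').antisymm fun x hx => ?_
  obtain ⟨hx₁, hx₀, hxQ⟩ := mem_latticeS.1 hx
  let μ : ℕ → ℕ := fun d => m d + m' d
  obtain ⟨u, v, Q, w, hp, hQs, hw, hr⟩ := exists_potentialPair (posetP n) (fun p => p.2 - 1)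
    (fun p => p.1 - 1) μ (n - 1) (fun α _ β _ h => Nat.sub_le_sub_right (Prod.le_def.1 h).2 1)
    (fun α _ β _ h => Nat.sub_le_sub_right (Prod.le_def.1 h).1 1)
    (fun α hα => Nat.sub_le_sub_right (mem_posetP.1 hα).2.1.le 1)
    (fun α hα => Nat.sub_le_sub_right (mem_posetP.1 hα).2.2 1) x fun α _ => hx₀ α
  have hwidth : ∀ d ∈ Finset.Icc 1 (n - 1), (finWidth (Q ∩ posetPd n d) : ℤ) ≤ w d := by
    intro d hd
    have := (Finset.mem_Icc.1 hd).1
    obtain ⟨A, hAQ, hA, hcard⟩ := exists_card_eq_finWidth (Q ∩ posetPd n d)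
    rw [← hcard]
    refine hw d A (hAQ.trans Finset.inter_subset_left) hA fun α hα => ?_
    obtain ⟨hα, h₁, h₂⟩ := Finset.mem_filter.1 (Finset.mem_inter.1 (hAQ hα)).2
    have := mem_posetP.1 hα
    omega
  have hrM : ∑ α ∈ posetP n, max 0 (x α - (v α - u α)) ≤ (M : ℤ) + M' := by
    have h₁ := hxQ Q hQs
    have h₂ : ∑ d ∈ Finset.Icc 1 (n - 1), (μ d : ℤ) * (finWidth (Q ∩ posetPd n d) : ℤ) ≤
        ∑ d ∈ Finset.Icc 1 (n - 1), (μ d : ℤ) * w d :=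
      Finset.sum_le_sum fun d hd => mul_le_mul_of_nonneg_left (hwidth d hd) (by positivity)
    push_cast at h₁
    simp only [μ] at h₂ hr
    push_cast at h₂ hr
    linarith
  obtain ⟨z, hz, hzM, hzM'⟩ := exists_split_of_sum_le (posetP n)
    (fun α => max 0 (x α - (v α - u α))) (fun α _ => le_max_left _ _) (by positivity)
    (by positivity) hrM
  let a : ℕ → ℤ := fun d => partialSum μ (d - 1)
  let g : ℤ → ℤ := levelCount a m (n - 1)
  let g' : ℤ → ℤ := levelCount (fun d => a d + m d) m' (n - 1)
  have hg : ∀ α ∈ posetP n, g (u α) ≤ g (v α) := fun α hα => levelCount_mono _ _ _ (hp.le α hα)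
  have hg' : ∀ α ∈ posetP n, g' (u α) ≤ g' (v α) := fun α hα => levelCount_mono _ _ _ (hp.le α hα)
  have hgg' : ∀ α ∈ posetP n, g (u α) + g' (u α) = u α ∧ g (v α) + g' (v α) = v α := by
    intro α hα
    have h₀ : 0 ≤ u α := (Finset.sum_nonneg fun _ _ => by positivity).trans (hp.lower α hα)
    have h₁ := hp.le α hα
    have h₂ := hp.upper α hα
    have h₃ := partialSum_mono μ (Nat.sub_le_sub_right (mem_posetP.1 hα).2.2 1)
    simp only [g, g', levelCount_add]
    constructor <;> refine (levelCount_partialSum μ (n - 1) (by omega)).trans (by omega)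
  have hμ : ∀ d, 1 ≤ d → partialSum μ d = a d + m d + m' d := by
    intro d hd
    obtain ⟨k, rfl⟩ := Nat.exists_eq_add_of_le' hd
    simp only [partialSum, a, Nat.add_sub_cancel]
    rw [Finset.sum_Icc_succ_top (by omega)]
    simp [μ, add_assoc]
  let y : ℕ × ℕ → ℤ := fun α => if α ∈ posetP n then
    min (x α - max 0 (x α - (v α - u α))) (g (v α) - g (u α)) + z α else 0
  refine ⟨y, hp.mem_latticeS_of_le (a := a) (z := z) (fun d hd => le_rfl)
      (fun d hd => by rw [hμ d hd]; omega) (fun α hα => by simp [y, hα]) (fun α => ?_)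
      (fun α hα => (hz α hα).1) hzM fun α hα => ?_,
    x - y, hp.mem_latticeS_of_le (a := fun d => a d + m d)
      (z := fun α => max 0 (x α - (v α - u α)) - z α) (fun d hd => by simp [a])
      (fun d hd => (hμ d hd).ge) (fun α hα => by simp [y, hα, hx₁ α hα]) (fun α => ?_)
      (fun α hα => sub_nonneg.2 (hz α hα).2) hzM' fun α hα => ?_, add_sub_cancel y x⟩
  · have h₀ := hx₀ α
    simp only [y]
    split_ifs with hα
    · have := hp.le α hα
      have := hg α hα
      have := hz α hα
      omega
    · exact le_rfl
  · simp only [y, if_pos hα]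
    exact add_le_add (min_le_right _ _) le_rfl
  · have h₀ := hx₀ α
    simp only [y, Pi.sub_apply]
    split_ifs with hα
    · have := hp.le α hα
      have := hz α hα
      omega
    · omega
  · have := hgg' α hα
    have := hg' α hα
    simp only [y, Pi.sub_apply, if_pos hα]
    change _ ≤ g' (v α) - g' (u α) + _
    omega
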